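/- Linear components typing: if Γ ⊢ M : {σ1,…,σn} is derivable in STR and the multiset of linear components of {σ1,…,σn} is [A1,…,Am], then for every i (1 ≤ i ≤ m) there exists a context Γi such that Γi ⊢ M : Ai is derivable in STR. -/

import Mathlib

/-! ## Untyped λ-calculus with named variables -/

inductive Term : Type
  | var : ℕ → Term
  | lam : ℕ → Term → Term
  | app : Term → Term → Term
deriving DecidableEq

namespace Term

/-- Free variables of a term. -/
def fv : Term → Finset ℕ
  | var x => {x}
  | lam x M => M.fv.erase x
  | app M N => M.fv ∪ N.fv

/-- Simultaneous substitution of terms for free variables. -/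
def subst (ρ : ℕ → Option Term) : Term → Term
  | var x => (ρ x).getD (var x)
  | lam x M => lam x (M.subst (fun y => if y = x then none else ρ y))
  | app M N => app (M.subst ρ) (N.subst ρ)

/-- Substitution `M[N/x]`. -/
def subst1 (M : Term) (x : ℕ) (N : Term) : Term :=
  M.subst (fun y => if y = x then some N else none)

/-- Renaming `M[x/x₁,…,x/xₙ]`. -/
def renameAll (M : Term) (xs : List ℕ) (x : ℕ) : Term :=
  M.subst (fun y => if y ∈ xs then some (var x) else none)

/-- Size of a term. -/
def size : Term → ℕ
  | var _ => 1
  | lam _ M => M.size + 1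
  | app M N => M.size + N.size + 1

/-- One step of β-reduction (contextual closure of `(λx.M)N → M[N/x]`). -/
inductive Beta : Term → Term → Prop
  | beta (x : ℕ) (M N : Term) : Beta (app (lam x M) N) (M.subst1 x N)
  | lam (x : ℕ) {M M' : Term} : Beta M M' → Beta (lam x M) (lam x M')
  | appL {M M' : Term} (N : Term) : Beta M M' → Beta (app M N) (app M' N)
  | appR (M : Term) {N N' : Term} : Beta N N' → Beta (app M N) (app M N')

end Term

/-- β-reduction in exactly `m` steps. -/
inductive BetaN : ℕ → Term → Term → Prop
  | refl (M : Term) : BetaN 0 M M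
  | step {M N P : Term} {m : ℕ} : Term.Beta M N → BetaN m N P → BetaN (m + 1) M P

/-- Strong normalization with respect to β-reduction. -/
def StronglyNormalizing (M : Term) : Prop := Acc (fun a b => Term.Beta b a) M

/-! ## STR types: linear and stratified types.
A stratified type `{σ₁,…,σₙ}` (n > 0) is represented as a head `σ₁` together with
the list `[σ₂,…,σₙ]` of the remaining components. -/

mutual
inductive LinTy : Type
  | tvar : ℕ → LinTy
  | arrow : STy → LinTy → LinTy
  | all : ℕ → LinTy → LinTy

inductive STy : Type
  | lin : LinTy → STy
  | strat : STy → List STy → STy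
end

mutual
/-- Free type variables of a linear type. -/
def LinTy.ftv : LinTy → Finset ℕ
  | .tvar a => {a}
  | .arrow σ A => σ.ftv ∪ A.ftv
  | .all a A => A.ftv.erase a

/-- Free type variables of a stratified type. -/
def STy.ftv : STy → Finset ℕ
  | .lin A => A.ftv
  | .strat σ l => σ.ftv ∪ STy.ftvList l

def STy.ftvList : List STy → Finset ℕ
  | [] => ∅
  | σ :: l => σ.ftv ∪ STy.ftvList l
end

mutual
/-- Substitution of the linear type `A` for the type variable `a`. -/
def LinTy.tsubst (a : ℕ) (A : LinTy) : LinTy → LinTy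
  | .tvar b => if b = a then A else .tvar b
  | .arrow σ B => .arrow (STy.tsubst a A σ) (LinTy.tsubst a A B)
  | .all b B => if b = a then .all b B else .all b (LinTy.tsubst a A B)
termination_by B => sizeOf B

def STy.tsubst (a : ℕ) (A : LinTy) : STy → STy
  | .lin B => .lin (LinTy.tsubst a A B)
  | .strat σ l => .strat (STy.tsubst a A σ) (STy.tsubstList a A l)
termination_by σ => sizeOf σ

def STy.tsubstList (a : ℕ) (A : LinTy) : List STy → List STy
  | [] => []
  | σ :: l => STy.tsubst a A σ :: STy.tsubstList a A l
termination_by l => sizeOf l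
end

mutual
/-- The (multi)set of linear components of a type, as a list. -/
def STy.linComps : STy → List LinTy
  | .lin A => [A]
  | .strat σ l => σ.linComps ++ STy.linCompsList l

def STy.linCompsList : List STy → List LinTy
  | [] => []
  | σ :: l => σ.linComps ++ STy.linCompsList l
end

/-! ## Contexts -/

/-- A context is a partial function from term variables to STR types. -/
abbrev Ctx := ℕ → Option STy

namespace Ctx

def dom (Γ : Ctx) : Set ℕ := {x | Γ x ≠ none}

def empty : Ctx := fun _ => none

/-- `Γ, x:σ`. -/
def cons (Γ : Ctx) (x : ℕ) (σ : STy) : Ctx := fun y => if y = x then some σ else Γ y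

/-- `Γ, x₁:σ₁, …, xₙ:σₙ`. -/
def consList (Γ : Ctx) (l : List (ℕ × STy)) : Ctx :=
  l.foldr (fun p Δ => Ctx.cons Δ p.1 p.2) Γ

/-- Concatenation `Γ, Δ` of two contexts (with disjoint domains). -/
def append (Γ Δ : Ctx) : Ctx := fun x => (Γ x).orElse (fun _ => Δ x)

def appendAll (l : List Ctx) : Ctx := l.foldr append empty

/-- `Γ # Δ` : disjointness of domains. -/
def Disj (Γ Δ : Ctx) : Prop := ∀ x, Γ x = none ∨ Δ x = none

/-- The context `∪ᵢ{Γᵢ}` of rule (st): `(∪ᵢ{Γᵢ})(x) = {Γ₀(x), Γ₁(x), …}`. -/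
def stratUnion (Γ0 : Ctx) (Γs : List Ctx) : Ctx := fun x =>
  (Γ0 x).map (fun σ => STy.strat σ (Γs.filterMap (fun Γ => Γ x)))

end Ctx

/-! ## The STR type assignment system.
`Deriv Γ M σ` is the type of STR derivations of `Γ ⊢ M : σ`. -/

inductive Deriv : Ctx → Term → STy → Type
  | ax (x : ℕ) (A : LinTy) :
      Deriv (Ctx.cons Ctx.empty x (.lin A)) (.var x) (.lin A)
  | w {Γ : Ctx} {M : Term} {σ : STy} (x : ℕ) (A : LinTy) (hx : Γ x = none) :
      Deriv Γ M σ → Deriv (Ctx.cons Γ x (.lin A)) M σ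
  | lam {Γ : Ctx} {M : Term} (x : ℕ) (σ : STy) (B : LinTy) (hx : Γ x = none) :
      Deriv (Ctx.cons Γ x σ) M (.lin B) →
      Deriv Γ (.lam x M) (.lin (.arrow σ B))
  | app {Γ1 Γ2 : Ctx} {M N : Term} {σ : STy} {A : LinTy}
      (hdisj : Ctx.Disj Γ1 Γ2) :
      Deriv Γ1 M (.lin (.arrow σ A)) → Deriv Γ2 N σ →
      Deriv (Ctx.append Γ1 Γ2) (.app M N) (.lin A)
  | m {Γ : Ctx} {M : Term} {τ : STy} (x x0 : ℕ) (xs : List ℕ) (σ0 : STy) (σs : List STy)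
      (hlen : xs.length = σs.length)
      (hnodup : (x0 :: xs).Nodup)
      (hfresh : ∀ y ∈ x0 :: xs, Γ y = none)
      (hx : Γ x = none) :
      Deriv (Ctx.consList Γ ((x0 :: xs).zip (σ0 :: σs))) M τ →
      Deriv (Ctx.cons Γ x (.strat σ0 σs)) (M.renameAll (x0 :: xs) x) τ
  | st {M : Term} (Γ0 : Ctx) (σ0 : STy) (k : ℕ) (Γs : Fin k → Ctx) (σs : Fin k → STy)
      (hdom : ∀ i, Ctx.dom (Γs i) = Ctx.dom Γ0)
      (p0 : Deriv Γ0 M σ0) (ps : ∀ i, Deriv (Γs i) M (σs i)) :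
      Deriv (Ctx.stratUnion Γ0 (List.ofFn Γs)) M (.strat σ0 (List.ofFn σs))
  | allI {Γ : Ctx} {M : Term} {A : LinTy} (a : ℕ)
      (ha : ∀ x σ, Γ x = some σ → a ∉ STy.ftv σ) :
      Deriv Γ M (.lin A) → Deriv Γ M (.lin (.all a A))
  | allE {Γ : Ctx} {M : Term} (a : ℕ) (B A : LinTy) :
      Deriv Γ M (.lin (.all a B)) → Deriv Γ M (.lin (B.tsubst a A))

/-- `M` is typable in STR. -/
def Typable (M : Term) : Prop := ∃ (Γ : Ctx) (σ : STy), Nonempty (Deriv Γ M σ)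

theorem STy.mem_linCompsList {A : LinTy} {l : List STy} :
    A ∈ STy.linCompsList l ↔ ∃ σ ∈ l, A ∈ σ.linComps := by
  induction l with
  | nil => simp [STy.linCompsList]
  | cons σ l ih => simp [STy.linCompsList, ih]

theorem Ctx.cons_eq_none {Γ : Ctx} {x y : ℕ} {σ : STy} :
    Ctx.cons Γ x σ y = none ↔ y ≠ x ∧ Γ y = none := by
  by_cases h : y = x <;> simp [Ctx.cons, h]

theorem Ctx.stratUnion_eq_none {Γ : Ctx} {Γs : List Ctx} {y : ℕ} :
    Ctx.stratUnion Γ Γs y = none ↔ Γ y = none := by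
  simp [Ctx.stratUnion]

theorem Ctx.consList_zip_eq_none {Γ : Ctx} {l : List ℕ} {σs : List STy}
    (h : l.length = σs.length) {y : ℕ} :
    Ctx.consList Γ (l.zip σs) y = none ↔ y ∉ l ∧ Γ y = none := by
  induction l generalizing σs with
  | nil => simp [Ctx.consList]
  | cons x l ih =>
    cases σs with
    | nil => simp at h
    | cons σ σs =>
      have := ih (σs := σs) (by simpa using h)
      change Ctx.cons (Ctx.consList Γ (l.zip σs)) x σ y = none ↔ _
      rw [Ctx.cons_eq_none, this]
      simp [and_assoc]

theorem Ctx.consList_zip_map (Γ : Ctx) (l : List ℕ) (f : ℕ → STy) (y : ℕ) :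
    Ctx.consList Γ (l.zip (l.map f)) y = if y ∈ l then some (f y) else Γ y := by
  induction l with
  | nil => simp [Ctx.consList]
  | cons x l ih =>
    change Ctx.cons (Ctx.consList Γ (l.zip (l.map f))) x (f x) y = _
    by_cases h : y = x <;> simp [Ctx.cons, h, ih]

/-- A context defined on all of `l` is the extension by `l` of its restriction away from `l`. -/
theorem Ctx.consList_restrict {Γ : Ctx} {l : List ℕ} (d : STy) (h : ∀ y ∈ l, Γ y ≠ none) :
    Ctx.consList (fun y => if y ∈ l then none else Γ y)
      (l.zip (l.map fun y => (Γ y).getD d)) = Γ := by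
  funext y
  rw [Ctx.consList_zip_map]
  by_cases hy : y ∈ l
  · obtain ⟨σ, hσ⟩ := Option.ne_none_iff_exists'.mp (h y hy)
    simp [hy, hσ]
  · simp [hy]

/-- Every linear component of a derivable type is derivable, in a context with the same domain. -/
theorem Deriv.exists_of_mem_linComps {Γ : Ctx} {M : Term} {σ : STy} (D : Deriv Γ M σ) :
    ∀ A ∈ σ.linComps, ∃ Γ' : Ctx, (∀ y, Γ' y = none ↔ Γ y = none) ∧
      Nonempty (Deriv Γ' M (.lin A)) := by
  have of_lin {Γ : Ctx} {M : Term} {B : LinTy} (D : Deriv Γ M (.lin B)) :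
      ∀ A ∈ (STy.lin B).linComps, ∃ Γ' : Ctx, (∀ y, Γ' y = none ↔ Γ y = none) ∧
        Nonempty (Deriv Γ' M (.lin A)) := by
    intro A hA
    obtain rfl : A = B := by simpa [STy.linComps] using hA
    exact ⟨Γ, fun _ => Iff.rfl, ⟨D⟩⟩
  induction D with
  | ax x A => exact of_lin (.ax x A)
  | lam x σ B hx D _ => exact of_lin (.lam x σ B hx D)
  | app hdisj D₁ D₂ _ _ => exact of_lin (.app hdisj D₁ D₂)
  | allI a ha D _ => exact of_lin (.allI a ha D)
  | allE a B A D _ => exact of_lin (.allE a B A D)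
  | w x B hx _ ih =>
    intro A hA
    obtain ⟨Γ', hdom, ⟨D⟩⟩ := ih A hA
    exact ⟨_, fun y => by simp [Ctx.cons_eq_none, hdom], ⟨.w x B ((hdom x).2 hx) D⟩⟩
  | st Γ0 σ0 k Γs σs hdom _ _ ih0 ih =>
    intro A hA
    rw [STy.linComps, List.mem_append, STy.mem_linCompsList] at hA
    rcases hA with hA | ⟨σ, hσ, hA⟩
    · obtain ⟨Γ', h, D⟩ := ih0 A hA
      exact ⟨Γ', fun y => by rw [h, Ctx.stratUnion_eq_none], D⟩
    · obtain ⟨i, rfl⟩ := (List.mem_ofFn' _ _).1 hσ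
      obtain ⟨Γ', h, D⟩ := ih i A hA
      refine ⟨Γ', fun y => ?_, D⟩
      rw [h, Ctx.stratUnion_eq_none]
      exact not_iff_not.1 (Set.ext_iff.1 (hdom i) y)
  | @m Γ M τ x x0 xs σ0 σs hlen hnodup hfresh hx _ ih =>
    intro A hA
    obtain ⟨Γ', hdom, ⟨D⟩⟩ := ih A hA
    have hdom' (y : ℕ) : Γ' y = none ↔ y ∉ x0 :: xs ∧ Γ y = none := by
      rw [hdom, Ctx.consList_zip_eq_none (by simpa using hlen)]
    rw [← Ctx.consList_restrict (Γ := Γ') (l := x0 :: xs) σ0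
      (fun y hy h => ((hdom' y).1 h).1 hy), List.map_cons] at D
    have restrict_eq_none (y : ℕ) :
        (if y ∈ x0 :: xs then none else Γ' y) = none ↔ Γ y = none := by
      by_cases hy : y ∈ x0 :: xs
      · simp only [if_pos hy, hfresh y hy]
      · rw [if_neg hy, hdom', and_iff_right hy]
    exact ⟨_, fun y => by rw [Ctx.cons_eq_none, Ctx.cons_eq_none, restrict_eq_none],
      ⟨.m x x0 xs _ _ (by simp) hnodup (fun y hy => if_pos hy)
        ((restrict_eq_none x).2 hx) D⟩⟩

/-- **Linear components typing**: if `Γ ⊢ M : {σ₁,…,σₙ}` is derivable in STR, then for every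
linear component `A` of `{σ₁,…,σₙ}` there is a context `Γ'` with `Γ' ⊢ M : A` derivable. -/
theorem linear_components_typing {Γ : Ctx} {M : Term} {σ0 : STy} {σl : List STy}
    (h : Nonempty (Deriv Γ M (.strat σ0 σl))) :
    ∀ A ∈ STy.linComps (.strat σ0 σl), ∃ Γ' : Ctx, Nonempty (Deriv Γ' M (.lin A)) := by
  obtain ⟨D⟩ := h
  intro A hA
  obtain ⟨Γ', -, D'⟩ := D.exists_of_mem_linComps A hA
  exact ⟨Γ', D'⟩
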